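/- arXiv:1211.2526 — 2 statements merged into one kernel-verified Lean document; each statement's English description precedes it below -/
import Mathlib

section
/- In the polynomial ring ℂ[t₁,…,t₁₀,u₁,u₂], the polynomial D_f = B_f² − 4A_f C_f, where A_f = a_f² − b_f d_f, B_f = a_f d_f − b_f c_f, C_f = d_f² − a_f c_f, has total degree at most 6 in the variables u₁, u₂: every monomial appearing in D_f with nonzero coefficient has its combined degree in u₁ and u₂ at most 6 (even though A_f, B_f, C_f individually have degree up to 6 in u₁, u₂, so that naively B_f² − 4A_f C_f could have degree 12). Equivalently, the branch-divisor polynomial D_f = 0 defines a curve of degree at most 6 in the plane with affine coordinates (u₁,u₂). -/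
/-!
Statement 3: In ℂ[t₁,…,t₁₀,u₁,u₂], the polynomial D_f = B_f² − 4A_fC_f has total
degree at most 6 in the variables u₁, u₂: every monomial appearing in D_f with a
nonzero coefficient has its combined degree in u₁ and u₂ at most 6.
We work in `MvPolynomial (Fin 12) ℂ`, where `X 0, …, X 9` are t₁, …, t₁₀,
`X 10 = u₁`, `X 11 = u₂`.
-/

open MvPolynomial

noncomputable section Stmt3

/-- the variable tᵢ₊₁ for `i : Fin 10` -/
def t (i : Fin 10) : MvPolynomial (Fin 12) ℂ := X ⟨(i : ℕ), by omega⟩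

def u₁ : MvPolynomial (Fin 12) ℂ := X 10
def u₂ : MvPolynomial (Fin 12) ℂ := X 11

def a_f : MvPolynomial (Fin 12) ℂ :=
  -t 0 * u₂ * u₁ ^ 2 + 2 * t 1 * u₂ * u₁ + t 2 * u₁ ^ 2 - t 3 * u₂ - t 4 * u₁ + t 7

def b_f : MvPolynomial (Fin 12) ℂ :=
  t 0 * u₁ ^ 3 - 3 * t 1 * u₁ ^ 2 + 3 * t 3 * u₁ - t 6

def c_f : MvPolynomial (Fin 12) ℂ :=
  -t 0 * u₂ ^ 3 + 3 * t 2 * u₂ ^ 2 - 3 * t 5 * u₂ + t 9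

def d_f : MvPolynomial (Fin 12) ℂ :=
  t 0 * u₂ ^ 2 * u₁ - t 1 * u₂ ^ 2 - 2 * t 2 * u₂ * u₁ + t 4 * u₂ + t 5 * u₁ - t 8

def A_f : MvPolynomial (Fin 12) ℂ := a_f ^ 2 - b_f * d_f
def B_f : MvPolynomial (Fin 12) ℂ := a_f * d_f - b_f * c_f
def C_f : MvPolynomial (Fin 12) ℂ := d_f ^ 2 - a_f * c_f

/-- the local equation D_f of the branch divisor -/
def D_f : MvPolynomial (Fin 12) ℂ := B_f ^ 2 - 4 * A_f * C_f

/-- The polynomials whose combined degree in `u₁` and `u₂` is at most `n`. -/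
def uDegreeLE (n : ℕ) : Submodule ℂ (MvPolynomial (Fin 12) ℂ) :=
  restrictSupport ℂ {m | m 10 + m 11 ≤ n}

lemma mem_uDegreeLE {n : ℕ} {p : MvPolynomial (Fin 12) ℂ} :
    p ∈ uDegreeLE n ↔ ∀ m ∈ p.support, m 10 + m 11 ≤ n := by
  rw [uDegreeLE, mem_restrictSupport_iff]
  rfl

lemma mul_mem_uDegreeLE {i j : ℕ} {p q : MvPolynomial (Fin 12) ℂ}
    (hp : p ∈ uDegreeLE i) (hq : q ∈ uDegreeLE j) : p * q ∈ uDegreeLE (i + j) := by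
  classical
  rw [mem_uDegreeLE] at *
  intro m hm
  obtain ⟨k, hk, l, hl, rfl⟩ := Finset.mem_add.mp (support_mul p q hm)
  have := hp k hk
  have := hq l hl
  simp only [Finsupp.add_apply]
  omega

lemma pow_mem_uDegreeLE {i : ℕ} {p : MvPolynomial (Fin 12) ℂ}
    (hp : p ∈ uDegreeLE i) (k : ℕ) : p ^ k ∈ uDegreeLE (k * i) := by
  induction k with
  | zero => simp [mem_uDegreeLE, support_one]
  | succ k ih =>
    rw [pow_succ, Nat.succ_mul]
    exact mul_mem_uDegreeLE ih hp

lemma uDegreeLE_mono {i j : ℕ} (h : i ≤ j) : uDegreeLE i ≤ uDegreeLE j :=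
  fun _ hp => mem_uDegreeLE.mpr fun m hm => (mem_uDegreeLE.mp hp m hm).trans h

lemma t_mem_uDegreeLE (i : Fin 10) : t i ∈ uDegreeLE 0 := by
  rw [mem_uDegreeLE]
  intro m hm
  rw [t, support_X, Finset.mem_singleton] at hm
  subst hm
  have := i.isLt
  simp [Finsupp.single_apply, Fin.ext_iff]
  omega

lemma u₁_mem_uDegreeLE : u₁ ∈ uDegreeLE 1 := by
  simp [mem_uDegreeLE, u₁, support_X]

lemma u₂_mem_uDegreeLE : u₂ ∈ uDegreeLE 1 := by
  simp [mem_uDegreeLE, u₂, support_X]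

lemma term_mem_uDegreeLE (k : ℤ) (l : Fin 10) {i j n : ℕ} (h : i + j ≤ n) :
    k • (t l * (u₁ ^ i * u₂ ^ j)) ∈ uDegreeLE n := by
  refine zsmul_mem (uDegreeLE_mono ?_ (mul_mem_uDegreeLE (t_mem_uDegreeLE l)
    (mul_mem_uDegreeLE (pow_mem_uDegreeLE u₁_mem_uDegreeLE i)
      (pow_mem_uDegreeLE u₂_mem_uDegreeLE j)))) k
  omega

lemma mem_uDegreeLE_of_u₁_pow_mul_mem {n k : ℕ} {p : MvPolynomial (Fin 12) ℂ}
    (h : u₁ ^ k * p ∈ uDegreeLE (n + k)) : p ∈ uDegreeLE n := by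
  rw [mem_uDegreeLE] at *
  intro m hm
  have hm' : Finsupp.single 10 k + m ∈ (u₁ ^ k * p).support := by
    rw [u₁, X_pow_eq_monomial, mem_support_iff, coeff_monomial_mul, one_mul]
    exact mem_support_iff.mp hm
  have := h _ hm'
  simp at this
  omega

/-- The discriminant (up to a constant) of the binary cubic
`p x³ + 3 q x² y + 3 r x y² + s y³`. -/
def cubicDisc (p q r s : MvPolynomial (Fin 12) ℂ) : MvPolynomial (Fin 12) ℂ :=
  (p * s - q * r) ^ 2 - 4 * ((q ^ 2 - p * r) * (r ^ 2 - q * s))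

lemma cubicDisc_mem_uDegreeLE {n : ℕ} {p q r s : MvPolynomial (Fin 12) ℂ}
    (hp : p ∈ uDegreeLE n) (hq : q ∈ uDegreeLE n) (hr : r ∈ uDegreeLE n)
    (hs : s ∈ uDegreeLE n) : cubicDisc p q r s ∈ uDegreeLE (4 * n) := by
  have hsq {x : MvPolynomial (Fin 12) ℂ} (hx : x ∈ uDegreeLE n) : x ^ 2 ∈ uDegreeLE (n + n) := by
    rw [sq]
    exact mul_mem_uDegreeLE hx hx
  have h₁ := pow_mem_uDegreeLE (sub_mem (mul_mem_uDegreeLE hp hs) (mul_mem_uDegreeLE hq hr)) 2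
  have h₂ := mul_mem_uDegreeLE (sub_mem (hsq hq) (mul_mem_uDegreeLE hp hr))
    (sub_mem (hsq hr) (mul_mem_uDegreeLE hq hs))
  have h₃ := nsmul_mem h₂ 4
  rw [nsmul_eq_mul, Nat.cast_ofNat] at h₃
  exact sub_mem (uDegreeLE_mono (by omega) h₁) (uDegreeLE_mono (by omega) h₃)

/-- The binary cubic with coefficients `-b_f, 3 a_f, -3 d_f, c_f` is `f` restricted to the line
`v₀ + u₁ v₁ + u₂ v₂ = 0`; the substitution `(x, y) ↦ (x + u₂ y, -u₁ y)`, of determinant `-u₁`,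
multiplies its discriminant by `u₁ ^ 6`. -/
lemma u₁_pow_mul_D_f :
    u₁ ^ 6 * D_f = cubicDisc (-b_f) (-b_f * u₂ - a_f * u₁)
      (-b_f * u₂ ^ 2 - 2 * a_f * u₁ * u₂ - d_f * u₁ ^ 2)
      (-b_f * u₂ ^ 3 - 3 * a_f * u₁ * u₂ ^ 2 - 3 * d_f * u₁ ^ 2 * u₂ - c_f * u₁ ^ 3) := by
  rw [D_f, A_f, B_f, C_f, cubicDisc]
  ring

lemma neg_b_f_mem_uDegreeLE :
    -b_f ∈ uDegreeLE 3 := by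
  have h : -b_f =
      (-1 : ℤ) • (t 0 * (u₁ ^ 3 * u₂ ^ 0))
        + (3 : ℤ) • (t 1 * (u₁ ^ 2 * u₂ ^ 0))
        + (-3 : ℤ) • (t 3 * (u₁ ^ 1 * u₂ ^ 0))
        + (1 : ℤ) • (t 6 * (u₁ ^ 0 * u₂ ^ 0)) := by
    simp only [b_f, zsmul_eq_mul]
    push_cast
    ring
  rw [h]
  repeat' apply add_mem
  all_goals exact term_mem_uDegreeLE _ _ (by omega)

lemma subst_coeff_one_mem_uDegreeLE :
    -b_f * u₂ - a_f * u₁ ∈ uDegreeLE 3 := by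
  have h : -b_f * u₂ - a_f * u₁ =
      (1 : ℤ) • (t 1 * (u₁ ^ 2 * u₂ ^ 1))
        + (-1 : ℤ) • (t 2 * (u₁ ^ 3 * u₂ ^ 0))
        + (-2 : ℤ) • (t 3 * (u₁ ^ 1 * u₂ ^ 1))
        + (1 : ℤ) • (t 4 * (u₁ ^ 2 * u₂ ^ 0))
        + (1 : ℤ) • (t 6 * (u₁ ^ 0 * u₂ ^ 1))
        + (-1 : ℤ) • (t 7 * (u₁ ^ 1 * u₂ ^ 0)) := by
    simp only [a_f, b_f, zsmul_eq_mul]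
    push_cast
    ring
  rw [h]
  repeat' apply add_mem
  all_goals exact term_mem_uDegreeLE _ _ (by omega)

lemma subst_coeff_two_mem_uDegreeLE :
    -b_f * u₂ ^ 2 - 2 * a_f * u₁ * u₂ - d_f * u₁ ^ 2 ∈ uDegreeLE 3 := by
  have h : -b_f * u₂ ^ 2 - 2 * a_f * u₁ * u₂ - d_f * u₁ ^ 2 =
      (-1 : ℤ) • (t 3 * (u₁ ^ 1 * u₂ ^ 2))
        + (1 : ℤ) • (t 4 * (u₁ ^ 2 * u₂ ^ 1))
        + (-1 : ℤ) • (t 5 * (u₁ ^ 3 * u₂ ^ 0))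
        + (1 : ℤ) • (t 6 * (u₁ ^ 0 * u₂ ^ 2))
        + (-2 : ℤ) • (t 7 * (u₁ ^ 1 * u₂ ^ 1))
        + (1 : ℤ) • (t 8 * (u₁ ^ 2 * u₂ ^ 0)) := by
    simp only [a_f, b_f, d_f, zsmul_eq_mul]
    push_cast
    ring
  rw [h]
  repeat' apply add_mem
  all_goals exact term_mem_uDegreeLE _ _ (by omega)

lemma subst_coeff_three_mem_uDegreeLE :
    -b_f * u₂ ^ 3 - 3 * a_f * u₁ * u₂ ^ 2 - 3 * d_f * u₁ ^ 2 * u₂ - c_f * u₁ ^ 3 ∈ uDegreeLE 3 := by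
  have h : -b_f * u₂ ^ 3 - 3 * a_f * u₁ * u₂ ^ 2 - 3 * d_f * u₁ ^ 2 * u₂ - c_f * u₁ ^ 3 =
      (1 : ℤ) • (t 6 * (u₁ ^ 0 * u₂ ^ 3))
        + (-3 : ℤ) • (t 7 * (u₁ ^ 1 * u₂ ^ 2))
        + (3 : ℤ) • (t 8 * (u₁ ^ 2 * u₂ ^ 1))
        + (-1 : ℤ) • (t 9 * (u₁ ^ 3 * u₂ ^ 0)) := by
    simp only [a_f, b_f, c_f, d_f, zsmul_eq_mul]
    push_cast
    ring
  rw [h]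
  repeat' apply add_mem
  all_goals exact term_mem_uDegreeLE _ _ (by omega)

/-- every monomial of `D_f` has combined degree at most 6 in the variables
`u₁ = X 10` and `u₂ = X 11`. -/
theorem statement3 :
    ∀ m ∈ D_f.support, m 10 + m 11 ≤ 6 := by
  rw [← mem_uDegreeLE]
  refine mem_uDegreeLE_of_u₁_pow_mul_mem (k := 6) ?_
  rw [u₁_pow_mul_D_f]
  exact cubicDisc_mem_uDegreeLE neg_b_f_mem_uDegreeLE subst_coeff_one_mem_uDegreeLE
    subst_coeff_two_mem_uDegreeLE subst_coeff_three_mem_uDegreeLE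

end Stmt3
end

section
/- Let a, b ∈ ℂ[t] be polynomials in one variable and let d ∈ ℂ with d ≠ 0. Then the subset V of ℂ³ (with coordinates (t, z, w) and the standard topology) defined by the three equations z² − a(t)z − b(t)w − 2(a(t)² − b(t)d) = 0, zw + dz + a(t)w + a(t)d = 0, and (w − 2d)(w + d) = 0 is a disconnected topological space. Indeed, V is the disjoint union of the two nonempty closed subsets V ∩ {w = 2d} (on which necessarily z = −a(t)) and V ∩ {w = −d}, which are disjoint because d ≠ 0. -/
/-!
Statement 5: For polynomials a, b ∈ ℂ[t] and a nonzero constant d ∈ ℂ, the subset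
V ⊆ ℂ³ (coordinates (t, z, w), standard topology) cut out by
  z² − a(t)z − b(t)w − 2(a(t)² − b(t)d) = 0,
  zw + dz + a(t)w + a(t)d = 0,
  (w − 2d)(w + d) = 0
is a disconnected (nonempty, non-connected) topological space: it is the disjoint
union of the two nonempty closed subsets V ∩ {w = 2d} and V ∩ {w = −d}.
-/

open Polynomial

/-- the locus in ℂ³ cut out by the three local equations of the restriction of the
triple cover to a line (in Miranda's local description, with `c = 0` and `d` a
constant); a point of ℂ³ is written `p = (t, z, w)`. -/
def V (a b : Polynomial ℂ) (d : ℂ) : Set (ℂ × ℂ × ℂ) :=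
  {p | p.2.1 ^ 2 - a.eval p.1 * p.2.1 - b.eval p.1 * p.2.2
          - 2 * ((a.eval p.1) ^ 2 - b.eval p.1 * d) = 0 ∧
       p.2.1 * p.2.2 + d * p.2.1 + a.eval p.1 * p.2.2 + a.eval p.1 * d = 0 ∧
       (p.2.2 - 2 * d) * (p.2.2 + d) = 0}

theorem isClosed_V (a b : Polynomial ℂ) (d : ℂ) : IsClosed (V a b d) := by
  have ha : Continuous fun p : ℂ × ℂ × ℂ => a.eval p.1 := a.continuous.comp continuous_fst
  have hb : Continuous fun p : ℂ × ℂ × ℂ => b.eval p.1 := b.continuous.comp continuous_fst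
  refine (isClosed_eq ?_ continuous_const).inter
    ((isClosed_eq ?_ continuous_const).inter (isClosed_eq ?_ continuous_const)) <;> fun_prop

theorem isClosed_V_inter (a b : Polynomial ℂ) (d c : ℂ) :
    IsClosed (V a b d ∩ {p | p.2.2 = c}) :=
  (isClosed_V a b d).inter (isClosed_eq (by fun_prop) continuous_const)

theorem V_inter_two_mul_nonempty (a b : Polynomial ℂ) (d : ℂ) :
    (V a b d ∩ {p | p.2.2 = 2 * d}).Nonempty :=
  ⟨(0, -a.eval 0, 2 * d), ⟨by ring, by ring, by ring⟩, rfl⟩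

/-- On `w = -d` the last two equations are automatic and the first is a monic quadratic in `z`. -/
theorem V_inter_neg_nonempty (a b : Polynomial ℂ) (d : ℂ) :
    (V a b d ∩ {p | p.2.2 = -d}).Nonempty := by
  obtain ⟨s, hs⟩ := IsAlgClosed.exists_pow_nat_eq (9 * a.eval 0 ^ 2 - 12 * b.eval 0 * d) two_pos
  exact ⟨(0, (a.eval 0 + s) / 2, -d), ⟨by linear_combination hs / 4, by ring, by ring⟩, rfl⟩

theorem V_eq_union (a b : Polynomial ℂ) (d : ℂ) :
    V a b d = (V a b d ∩ {p | p.2.2 = 2 * d}) ∪ (V a b d ∩ {p | p.2.2 = -d}) := by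
  rw [← Set.inter_union_distrib_left, eq_comm, Set.inter_eq_left]
  exact fun p hp => (mul_eq_zero.mp hp.2.2).imp sub_eq_zero.mp eq_neg_of_add_eq_zero_left

theorem V_inter_two_mul_inter_V_inter_neg (a b : Polynomial ℂ) {d : ℂ} (hd : d ≠ 0) :
    (V a b d ∩ {p | p.2.2 = 2 * d}) ∩ (V a b d ∩ {p | p.2.2 = -d}) = ∅ := by
  refine Set.eq_empty_of_forall_notMem fun p ⟨⟨_, h₁⟩, ⟨_, h₂⟩⟩ => hd ?_
  linear_combination (h₂.symm.trans h₁) / (-3)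

theorem eq_neg_eval_of_mem_V_inter_two_mul (a b : Polynomial ℂ) {d : ℂ} (hd : d ≠ 0)
    {p : ℂ × ℂ × ℂ} (hp : p ∈ V a b d ∩ {p | p.2.2 = 2 * d}) : p.2.1 = -a.eval p.1 := by
  obtain ⟨⟨_, h, _⟩, hw : p.2.2 = 2 * d⟩ := hp
  rw [hw] at h
  have h3 : (3 * d) * (p.2.1 + a.eval p.1) = 0 := by linear_combination h
  exact eq_neg_of_add_eq_zero_left
    ((mul_eq_zero.mp h3).resolve_left (mul_ne_zero three_ne_zero hd))

theorem not_isPreconnected_V (a b : Polynomial ℂ) {d : ℂ} (hd : d ≠ 0) :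
    ¬ IsPreconnected (V a b d) := by
  intro h
  have hne := isPreconnected_closed_iff.mp h _ _ (isClosed_V_inter a b d (2 * d))
    (isClosed_V_inter a b d (-d)) (V_eq_union a b d).subset
    ((V_inter_two_mul_nonempty a b d).mono fun _ hp => ⟨hp.1, hp⟩)
    ((V_inter_neg_nonempty a b d).mono fun _ hp => ⟨hp.1, hp⟩)
  rw [V_inter_two_mul_inter_V_inter_neg a b hd, Set.inter_empty] at hne
  exact Set.not_nonempty_empty hne

theorem statement5 (a b : Polynomial ℂ) (d : ℂ) (hd : d ≠ 0) :
    ((V a b d).Nonempty ∧ ¬ IsPreconnected (V a b d)) ∧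
      V a b d = (V a b d ∩ {p | p.2.2 = 2 * d}) ∪ (V a b d ∩ {p | p.2.2 = -d}) ∧
      (V a b d ∩ {p | p.2.2 = 2 * d}).Nonempty ∧
      (V a b d ∩ {p | p.2.2 = -d}).Nonempty ∧
      (V a b d ∩ {p | p.2.2 = 2 * d}) ∩ (V a b d ∩ {p | p.2.2 = -d}) = ∅ ∧
      IsClosed (V a b d ∩ {p | p.2.2 = 2 * d}) ∧
      IsClosed (V a b d ∩ {p | p.2.2 = -d}) ∧
      ∀ p ∈ V a b d ∩ {p | p.2.2 = 2 * d}, p.2.1 = -a.eval p.1 :=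
  ⟨⟨(V_inter_two_mul_nonempty a b d).left, not_isPreconnected_V a b hd⟩,
    V_eq_union a b d, V_inter_two_mul_nonempty a b d, V_inter_neg_nonempty a b d,
    V_inter_two_mul_inter_V_inter_neg a b hd, isClosed_V_inter a b d _, isClosed_V_inter a b d _,
    fun _ hp => eq_neg_eval_of_mem_V_inter_two_mul a b hd hp⟩
end
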